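/- Let G be a spray on an open set U ⊆ ℝⁿ (n ≥ 2) of the form Gⁱ = P yⁱ for some smooth function P(x,y) positively homogeneous of degree 1 in y (i.e., G is projectively flat in these coordinates). If the χ-curvature of G vanishes, then G is of isotropic curvature. -/

import Mathlib

open scoped BigOperators

noncomputable section

/-- Points/vectors in local coordinates on an open subset of `ℝⁿ`. -/
abbrev Vec (n : ℕ) := Fin n → ℝ

variable {n : ℕ}

/-- Partial derivative in the base (`x`) variable, in the `k`-th coordinate direction. -/
noncomputable def pdx (f : Vec n → Vec n → ℝ) (k : Fin n) (x y : Vec n) : ℝ :=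
  fderiv ℝ (fun x' => f x' y) x (Pi.single k 1)

/-- Partial derivative in the fiber (`y`) variable, in the `k`-th coordinate direction;
this is the operation denoted by a subscript `·k`. -/
noncomputable def pdy (f : Vec n → Vec n → ℝ) (k : Fin n) (x y : Vec n) : ℝ :=
  fderiv ℝ (fun y' => f x y') y (Pi.single k 1)

/-- Partial derivative of a function of `x` alone. -/
noncomputable def pd (f : Vec n → ℝ) (k : Fin n) (x : Vec n) : ℝ :=
  fderiv ℝ f x (Pi.single k 1)

/-- `G` is a spray on the open set `U ⊆ ℝⁿ`: the coefficients `Gⁱ(x,y)` are smooth for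
`x ∈ U`, `y ≠ 0`, and positively homogeneous of degree `2` in `y`. -/
def IsSpray (U : Set (Vec n)) (G : Fin n → Vec n → Vec n → ℝ) : Prop :=
  (∀ i, ContDiffOn ℝ (⊤ : ℕ∞) (fun p : Vec n × Vec n => G i p.1 p.2)
      (U ×ˢ {y : Vec n | y ≠ 0})) ∧
  (∀ i (x y : Vec n) (lam : ℝ), 0 < lam → G i x (lam • y) = lam ^ 2 * G i x y)

/-- `N^i_j := ∂G^i/∂y^j`. -/
noncomputable def Nc (G : Fin n → Vec n → Vec n → ℝ) (i j : Fin n) (x y : Vec n) : ℝ :=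
  pdy (G i) j x y

/-- `Γ^i_{jk} := ∂²G^i/∂y^j∂y^k`. -/
noncomputable def Ga (G : Fin n → Vec n → Vec n → ℝ) (i j k : Fin n) (x y : Vec n) : ℝ :=
  pdy (Nc G i j) k x y

/-- The horizontal derivative `δf/δx^k := ∂f/∂x^k − N^m_k ∂f/∂y^m`; for a scalar `f` this is
also the horizontal covariant derivative `f_{|k}`. -/
noncomputable def hd (G : Fin n → Vec n → Vec n → ℝ) (f : Vec n → Vec n → ℝ)
    (k : Fin n) (x y : Vec n) : ℝ :=
  pdx f k x y - ∑ m, Nc G m k x y * pdy f m x y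

/-- The four-index Riemann curvature tensor
`R_j{}^i{}_{kl} := δΓⁱ_{jl}/δx^k − δΓⁱ_{jk}/δx^l + Γⁱ_{ks}Γ^s_{jl} − Γ^s_{jk}Γⁱ_{ls}`. -/
noncomputable def Riem4 (G : Fin n → Vec n → Vec n → ℝ) (j i k l : Fin n)
    (x y : Vec n) : ℝ :=
  hd G (Ga G i j l) k x y - hd G (Ga G i j k) l x y
    + ∑ s, (Ga G i k s x y * Ga G s j l x y - Ga G s j k x y * Ga G i l s x y)

/-- The two-index Riemann curvature `R^i_k := y^j R_j{}^i{}_{kl} y^l`. -/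
noncomputable def Riem2 (G : Fin n → Vec n → Vec n → ℝ) (i k : Fin n)
    (x y : Vec n) : ℝ :=
  ∑ j, ∑ l, y j * Riem4 G j i k l x y * y l

/-- The χ-curvature `χ_k := −(1/6)(2 R^m_{k·m} + R^m_{m·k})`. -/
noncomputable def chi (G : Fin n → Vec n → Vec n → ℝ) (k : Fin n) (x y : Vec n) : ℝ :=
  -(1 / 6) * (2 * ∑ m, pdy (Riem2 G m k) m x y + ∑ m, pdy (Riem2 G m m) k x y)

/-- The scalar `R := (1/(n−1)) R^m_m`. -/
noncomputable def Rsc (G : Fin n → Vec n → Vec n → ℝ) (x y : Vec n) : ℝ :=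
  (1 / ((n : ℝ) - 1)) * ∑ m, Riem2 G m m x y

/-- `Π := ∂G^m/∂y^m`. -/
noncomputable def PiG (G : Fin n → Vec n → Vec n → ℝ) (x y : Vec n) : ℝ :=
  ∑ m, Nc G m m x y

/-- The S-curvature of `(G, dV)` for the volume form `dV = σ(x) dx¹⋯dxⁿ`:
`S := Π − y^m ∂(ln σ)/∂x^m`. -/
noncomputable def Scurv (G : Fin n → Vec n → Vec n → ℝ) (σ : Vec n → ℝ)
    (x y : Vec n) : ℝ :=
  PiG G x y - ∑ m, y m * pd (fun x' => Real.log (σ x')) m x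

/-- The spray `Ĝ` associated with `(G, dV)`: `Ĝⁱ := Gⁱ − (S/(n+1)) yⁱ`. -/
noncomputable def Ghat (G : Fin n → Vec n → Vec n → ℝ) (σ : Vec n → ℝ)
    (i : Fin n) (x y : Vec n) : ℝ :=
  G i x y - (Scurv G σ x y / ((n : ℝ) + 1)) * y i

/-- `σ` is the (positive, smooth) density of a volume form `dV = σ(x) dx¹⋯dxⁿ` on `U`. -/
def IsVolumeForm (U : Set (Vec n)) (σ : Vec n → ℝ) : Prop :=
  ContDiffOn ℝ (⊤ : ℕ∞) σ U ∧ ∀ x ∈ U, 0 < σ x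

/-- `G` is of isotropic curvature on `U`: `Rⁱ_k = R δⁱ_k − (1/2) R_{·k} yⁱ`. -/
def IsIsotropicCurv (U : Set (Vec n)) (G : Fin n → Vec n → Vec n → ℝ) : Prop :=
  ∀ x ∈ U, ∀ y : Vec n, y ≠ 0 → ∀ i k,
    Riem2 G i k x y
      = Rsc G x y * (if i = k then 1 else 0) - (1 / 2) * pdy (Rsc G) k x y * y i

/-- `G` is of scalar curvature on `U`: `Rⁱ_k = R δⁱ_k − τ_k yⁱ` for some functions `τ_k`,
positively homogeneous of degree one in `y`, with `τ_k y^k = R`. -/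
def IsScalarCurv (U : Set (Vec n)) (G : Fin n → Vec n → Vec n → ℝ) : Prop :=
  ∃ τ : Fin n → Vec n → Vec n → ℝ,
    (∀ k (x y : Vec n) (lam : ℝ), 0 < lam → τ k x (lam • y) = lam * τ k x y) ∧
    ∀ x ∈ U, ∀ y : Vec n, y ≠ 0 →
      (∑ k, τ k x y * y k) = Rsc G x y ∧
      ∀ i k, Riem2 G i k x y
        = Rsc G x y * (if i = k then 1 else 0) - τ k x y * y i

/-- `f(x,y)` is smooth for `x ∈ U`, `y ≠ 0`. -/
def SmoothOnSlit (U : Set (Vec n)) (f : Vec n → Vec n → ℝ) : Prop :=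
  ContDiffOn ℝ (⊤ : ℕ∞) (fun p : Vec n × Vec n => f p.1 p.2) (U ×ˢ {y : Vec n | y ≠ 0})

/-- `f(x,y)` is positively homogeneous of degree `d` in `y`. -/
def PosHomFiber (d : ℕ) (f : Vec n → Vec n → ℝ) : Prop :=
  ∀ (x y : Vec n) (lam : ℝ), 0 < lam → f x (lam • y) = lam ^ d * f x y

theorem isOpen_slit {U : Set (Vec n)} (hU : IsOpen U) :
    IsOpen (U ×ˢ {y : Vec n | y ≠ 0}) :=
  hU.prod isOpen_ne

theorem slit_mem_nhds {U : Set (Vec n)} (hU : IsOpen U) {x y : Vec n} (hx : x ∈ U) (hy : y ≠ 0) :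
    U ×ˢ {y : Vec n | y ≠ 0} ∈ nhds (x, y) :=
  (isOpen_slit hU).mem_nhds ⟨hx, hy⟩

theorem fderiv_const_mul_real (c : ℝ) (f : Vec n → ℝ) (x : Vec n) :
    fderiv ℝ (fun y => c * f y) x = c • fderiv ℝ f x :=
  congrFun (fderiv_const_smul_field c) x

section Congr

variable {U : Set (Vec n)} {f g : Vec n → Vec n → ℝ} {x y : Vec n}

theorem pdy_congr (h : ∀ x ∈ U, ∀ y : Vec n, y ≠ 0 → f x y = g x y) (hx : x ∈ U) (hy : y ≠ 0)
    (k : Fin n) : pdy f k x y = pdy g k x y := by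
  have : (fun y' => f x y') =ᶠ[nhds y] fun y' => g x y' := by
    filter_upwards [isOpen_ne.mem_nhds hy] with z hz using h x hx z hz
  rw [pdy, pdy, this.fderiv_eq]

theorem pdx_congr (hU : IsOpen U) (h : ∀ x ∈ U, ∀ y : Vec n, y ≠ 0 → f x y = g x y)
    (hx : x ∈ U) (hy : y ≠ 0) (k : Fin n) : pdx f k x y = pdx g k x y := by
  have : (fun x' => f x' y) =ᶠ[nhds x] fun x' => g x' y := by
    filter_upwards [hU.mem_nhds hx] with z hz using h z hz y hy
  rw [pdx, pdx, this.fderiv_eq]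

end Congr

namespace SmoothOnSlit

variable {U : Set (Vec n)} {f g : Vec n → Vec n → ℝ} {x y : Vec n}

theorem differentiableAt (hf : SmoothOnSlit U f) (hU : IsOpen U) (hx : x ∈ U) (hy : y ≠ 0) :
    DifferentiableAt ℝ (fun p : Vec n × Vec n => f p.1 p.2) (x, y) :=
  (ContDiffOn.contDiffAt hf (slit_mem_nhds hU hx hy)).differentiableAt (by simp)

theorem differentiableAt_fiber (hf : SmoothOnSlit U f) (hU : IsOpen U) (hx : x ∈ U)
    (hy : y ≠ 0) : DifferentiableAt ℝ (fun y' => f x y') y :=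
  (hf.differentiableAt hU hx hy).comp (f := fun y' : Vec n => (x, y')) y (by fun_prop)

theorem differentiableAt_base (hf : SmoothOnSlit U f) (hU : IsOpen U) (hx : x ∈ U)
    (hy : y ≠ 0) : DifferentiableAt ℝ (fun x' => f x' y) x :=
  (hf.differentiableAt hU hx hy).comp (f := fun x' : Vec n => (x', y)) x (by fun_prop)

theorem pdy_eq_fderiv (hf : SmoothOnSlit U f) (hU : IsOpen U) (hx : x ∈ U) (hy : y ≠ 0)
    (k : Fin n) :
    pdy f k x y = fderiv ℝ (fun p : Vec n × Vec n => f p.1 p.2) (x, y) (0, Pi.single k 1) := by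
  have h := (hf.differentiableAt hU hx hy).hasFDerivAt.comp y (hasFDerivAt_prodMk_right x y)
  have h' : HasFDerivAt (fun y' => f x y') _ y := h
  rw [pdy, h'.fderiv]
  simp

theorem pdx_eq_fderiv (hf : SmoothOnSlit U f) (hU : IsOpen U) (hx : x ∈ U) (hy : y ≠ 0)
    (k : Fin n) :
    pdx f k x y = fderiv ℝ (fun p : Vec n × Vec n => f p.1 p.2) (x, y) (Pi.single k 1, 0) := by
  have h := (hf.differentiableAt hU hx hy).hasFDerivAt.comp (f := fun x' => (x', y)) x
    (hasFDerivAt_prodMk_left x y)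
  have h' : HasFDerivAt (fun x' => f x' y) _ x := h
  rw [pdx, h'.fderiv]
  simp

theorem contDiffOn_fderiv (hf : SmoothOnSlit U f) (hU : IsOpen U) (v : Vec n × Vec n) :
    ContDiffOn ℝ (⊤ : ℕ∞) (fun p => fderiv ℝ (fun p : Vec n × Vec n => f p.1 p.2) p v)
      (U ×ˢ {y : Vec n | y ≠ 0}) :=
  (ContDiffOn.fderiv_of_isOpen hf (isOpen_slit hU) (by simp)).clm_apply contDiffOn_const

theorem pdy (hf : SmoothOnSlit U f) (hU : IsOpen U) (k : Fin n) : SmoothOnSlit U (pdy f k) :=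
  (hf.contDiffOn_fderiv hU (0, Pi.single k 1)).congr
    fun _ hp => hf.pdy_eq_fderiv hU hp.1 hp.2 k

theorem pdx (hf : SmoothOnSlit U f) (hU : IsOpen U) (k : Fin n) : SmoothOnSlit U (pdx f k) :=
  (hf.contDiffOn_fderiv hU (Pi.single k 1, 0)).congr
    fun _ hp => hf.pdx_eq_fderiv hU hp.1 hp.2 k

theorem sub (hf : SmoothOnSlit U f) (hg : SmoothOnSlit U g) :
    SmoothOnSlit U fun x y => f x y - g x y :=
  ContDiffOn.sub hf hg

theorem mul (hf : SmoothOnSlit U f) (hg : SmoothOnSlit U g) :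
    SmoothOnSlit U fun x y => f x y * g x y :=
  ContDiffOn.mul hf hg

theorem const (c : ℝ) : SmoothOnSlit U fun _ _ => c :=
  contDiffOn_const

theorem coord (i : Fin n) : SmoothOnSlit U fun _ y => y i :=
  ContDiff.contDiffOn (by fun_prop)

theorem sum {F : Fin n → Vec n → Vec n → ℝ} (hF : ∀ i, SmoothOnSlit U (F i)) :
    SmoothOnSlit U fun x y => ∑ i, F i x y :=
  ContDiffOn.sum fun i _ => hF i

end SmoothOnSlit

section Rules

variable {U : Set (Vec n)} {f g : Vec n → Vec n → ℝ} {x y : Vec n}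

theorem pdy_add (hU : IsOpen U) (hf : SmoothOnSlit U f) (hg : SmoothOnSlit U g)
    (hx : x ∈ U) (hy : y ≠ 0) (k : Fin n) :
    pdy (fun x y => f x y + g x y) k x y = pdy f k x y + pdy g k x y := by
  simp [pdy, fderiv_fun_add (hf.differentiableAt_fiber hU hx hy)
    (hg.differentiableAt_fiber hU hx hy)]

theorem pdx_add (hU : IsOpen U) (hf : SmoothOnSlit U f) (hg : SmoothOnSlit U g)
    (hx : x ∈ U) (hy : y ≠ 0) (k : Fin n) :
    pdx (fun x y => f x y + g x y) k x y = pdx f k x y + pdx g k x y := by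
  simp [pdx, fderiv_fun_add (hf.differentiableAt_base hU hx hy)
    (hg.differentiableAt_base hU hx hy)]

theorem pdy_mul_const (c : ℝ) (k : Fin n) :
    pdy (fun x y => f x y * c) k x y = pdy f k x y * c := by
  simp only [pdy, mul_comm _ c]
  simp [fderiv_const_mul_real]

theorem pdx_mul_const (c : ℝ) (k : Fin n) :
    pdx (fun x y => f x y * c) k x y = pdx f k x y * c := by
  simp only [pdx, mul_comm _ c]
  simp [fderiv_const_mul_real]

theorem pdx_mul_coord (i k : Fin n) :
    pdx (fun x y => f x y * y i) k x y = pdx f k x y * y i :=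
  pdx_mul_const (y i) k

theorem pdy_mul_coord (hU : IsOpen U) (hf : SmoothOnSlit U f) (hx : x ∈ U) (hy : y ≠ 0)
    (i k : Fin n) :
    pdy (fun x y => f x y * y i) k x y
      = pdy f k x y * y i + f x y * (if i = k then 1 else 0) := by
  have h : HasFDerivAt (fun y' : Vec n => y' i) (ContinuousLinearMap.proj (R := ℝ) i) y :=
    hasFDerivAt_apply i y
  have := ((hf.differentiableAt_fiber hU hx hy).hasFDerivAt.mul h).fderiv
  simp only [pdy]
  erw [this]
  simp [Pi.single_apply]
  ring

theorem pdy_sum_coord_mul (hU : IsOpen U) {F : Fin n → Vec n → Vec n → ℝ}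
    (hF : ∀ i, SmoothOnSlit U (F i)) (hx : x ∈ U) (hy : y ≠ 0) (k : Fin n) :
    pdy (fun x y => ∑ i, F i x y * y i) k x y
      = ∑ i, pdy (F i) k x y * y i + F k x y := by
  have h : pdy (fun x y => ∑ i, F i x y * y i) k x y
      = ∑ i, pdy (fun x y => F i x y * y i) k x y := by
    simp only [pdy]
    rw [fderiv_fun_sum fun i _ =>
      ((hF i).mul (SmoothOnSlit.coord i)).differentiableAt_fiber hU hx hy]
    simp
  rw [h, Finset.sum_congr rfl fun i _ => pdy_mul_coord hU (hF i) hx hy i k,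
    Finset.sum_add_distrib]
  simp

theorem pdx_sum_coord_mul (hU : IsOpen U) {F : Fin n → Vec n → Vec n → ℝ}
    (hF : ∀ i, SmoothOnSlit U (F i)) (hx : x ∈ U) (hy : y ≠ 0) (k : Fin n) :
    pdx (fun x y => ∑ i, F i x y * y i) k x y = ∑ i, pdx (F i) k x y * y i := by
  have h : pdx (fun x y => ∑ i, F i x y * y i) k x y
      = ∑ i, pdx (fun x y => F i x y * y i) k x y := by
    simp only [pdx]
    rw [fderiv_fun_sum fun i _ =>
      ((hF i).mul (SmoothOnSlit.coord i)).differentiableAt_base hU hx hy]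
    simp
  rw [h, Finset.sum_congr rfl fun i _ => pdx_mul_coord i k]

theorem pdy_comm (hU : IsOpen U) (hf : SmoothOnSlit U f) (hx : x ∈ U) (hy : y ≠ 0)
    (j k : Fin n) : pdy (pdy f j) k x y = pdy (pdy f k) j x y := by
  set F : Vec n × Vec n → ℝ := fun p => f p.1 p.2
  have hF : ContDiffAt ℝ (⊤ : ℕ∞) F (x, y) :=
    hf.contDiffAt (slit_mem_nhds hU hx hy)
  have hd : DifferentiableAt ℝ (fderiv ℝ F) (x, y) :=
    (hF.fderiv_right (m := (⊤ : ℕ∞)) (by simp)).differentiableAt (by simp)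
  have key : ∀ j k : Fin n, pdy (pdy f j) k x y
      = fderiv ℝ (fderiv ℝ F) (x, y) (0, Pi.single k 1) (0, Pi.single j 1) := by
    intro j k
    rw [(hf.pdy hU j).pdy_eq_fderiv hU hx hy k]
    have : (fun p : Vec n × Vec n => pdy f j p.1 p.2) =ᶠ[nhds (x, y)]
        fun p => fderiv ℝ F p (0, Pi.single j 1) := by
      filter_upwards [slit_mem_nhds hU hx hy] with p hp
        using hf.pdy_eq_fderiv hU hp.1 hp.2 j
    rw [this.fderiv_eq, fderiv_clm_apply hd (differentiableAt_const _)]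
    simp
  rw [key, key]
  exact hF.isSymmSndFDerivAt (by
    rw [minSmoothness_of_isRCLikeNormedField]
    exact WithTop.coe_le_coe.mpr (le_top : (2 : ℕ∞) ≤ ⊤)) _ _

end Rules

namespace PosHomFiber

variable {f g : Vec n → Vec n → ℝ} {d e : ℕ}

theorem pdx (hf : PosHomFiber d f) (k : Fin n) : PosHomFiber d (pdx f k) := by
  intro x y lam hlam
  simp only [_root_.pdx, hf _ y lam hlam]
  simp [fderiv_const_mul_real]

theorem pdy (hf : PosHomFiber (d + 1) f) (k : Fin n) : PosHomFiber d (pdy f k) := by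
  intro x y lam hlam
  have h1 : fderiv ℝ (fun y' => f x (lam • y')) y
      = lam • fderiv ℝ (fun y' => f x y') (lam • y) :=
    fderiv_comp_smul (f := fun y' => f x y') lam
  have h2 : fderiv ℝ (fun y' => f x (lam • y')) y
      = lam ^ (d + 1) • fderiv ℝ (fun y' => f x y') y := by
    simp only [hf x _ lam hlam]
    simp [fderiv_const_mul_real]
  have h3 := congrArg (fun L => L (Pi.single k (1 : ℝ))) (h1.symm.trans h2)
  simp only [smul_apply, smul_eq_mul, pow_succ'] at h3
  rw [mul_assoc] at h3
  exact mul_left_cancel₀ hlam.ne' h3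

theorem sub (hf : PosHomFiber d f) (hg : PosHomFiber d g) :
    PosHomFiber d fun x y => f x y - g x y := by
  intro x y lam hlam
  simp only [hf x y lam hlam, hg x y lam hlam, mul_sub]

theorem mul (hf : PosHomFiber d f) (hg : PosHomFiber e g) :
    PosHomFiber (d + e) fun x y => f x y * g x y := by
  intro x y lam hlam
  simp only [hf x y lam hlam, hg x y lam hlam]
  ring

theorem const (c : ℝ) : PosHomFiber 0 fun _ _ : Vec n => c := by
  intro x y lam _
  simp

theorem coord (i : Fin n) : PosHomFiber 1 fun _ y : Vec n => y i := by
  intro x y lam _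
  simp

theorem sum {F : Fin n → Vec n → Vec n → ℝ} (hF : ∀ i, PosHomFiber d (F i)) :
    PosHomFiber d fun x y => ∑ i, F i x y := by
  intro x y lam hlam
  simp only [hF _ x y lam hlam, Finset.mul_sum]

/-- The Euler relation in the fiber variable. -/
theorem euler {U : Set (Vec n)} {x y : Vec n} (hf : PosHomFiber d f) (hU : IsOpen U)
    (hs : SmoothOnSlit U f) (hx : x ∈ U) (hy : y ≠ 0) :
    ∑ m, _root_.pdy f m x y * y m = d * f x y := by
  have hray : HasDerivAt (fun t : ℝ => t • y) y 1 := by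
    simpa using (hasDerivAt_id (1 : ℝ)).smul_const y
  have hd : HasFDerivAt (fun y' => f x y') (fderiv ℝ (fun y' => f x y') y) ((1 : ℝ) • y) := by
    simpa using (hs.differentiableAt_fiber hU hx hy).hasFDerivAt
  have h1 := hd.comp_hasDerivAt (1 : ℝ) hray
  have h2 : HasDerivAt (fun t : ℝ => t ^ d * f x y) (d * f x y) 1 := by
    simpa using (hasDerivAt_pow d (1 : ℝ)).mul_const (f x y)
  have heq : ((fun y' => f x y') ∘ fun t : ℝ => t • y) =ᶠ[nhds 1] fun t => t ^ d * f x y := by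
    filter_upwards [lt_mem_nhds one_pos] with t ht using hf x y t ht
  rw [← h1.unique (h2.congr_of_eventuallyEq heq)]
  have hy' : y = ∑ m, y m • Pi.single m (1 : ℝ) := by
    conv_lhs => rw [← Finset.univ_sum_single y]
    refine Finset.sum_congr rfl fun m _ => ?_
    simp [← Pi.single_smul]
  rw [congrArg (fderiv ℝ (fun y' => f x y') y) hy']
  simp only [map_sum, map_smul, smul_eq_mul, _root_.pdy, mul_comm]

end PosHomFiber

/-- The Riemann curvature of a spray in terms of its coefficients:
`Rⁱ_k = 2 ∂_k Gⁱ − y^l ∂_l Nⁱ_k + 2 G^s Γⁱ_{ks} − N^s_k Nⁱ_s`. -/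
theorem IsSpray.riem2_eq {U : Set (Vec n)} {G : Fin n → Vec n → Vec n → ℝ} (hG : IsSpray U G)
    (hU : IsOpen U) {x y : Vec n} (hx : x ∈ U) (hy : y ≠ 0) (i k : Fin n) :
    Riem2 G i k x y = 2 * pdx (G i) k x y - ∑ l, pdx (Nc G i k) l x y * y l
      + ∑ s, 2 * G s x y * Ga G i k s x y - ∑ s, Nc G s k x y * Nc G i s x y := by
  have sG : ∀ i, SmoothOnSlit U (G i) := hG.1
  have hom : ∀ i, PosHomFiber 2 (G i) := hG.2
  have sN : ∀ i j, SmoothOnSlit U (Nc G i j) := fun i j => (sG i).pdy hU j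
  have sGa : ∀ i j l, SmoothOnSlit U (Ga G i j l) := fun i j l => (sN i j).pdy hU l
  have eN : ∀ i, ∀ x ∈ U, ∀ y : Vec n, y ≠ 0 → ∑ l, Nc G i l x y * y l = G i x y * 2 := by
    intro i x hx y hy
    rw [mul_comm]
    exact_mod_cast (hom i).euler hU (sG i) hx hy
  have symm : ∀ i j l, ∀ x ∈ U, ∀ y : Vec n, y ≠ 0 → Ga G i j l x y = Ga G i l j x y :=
    fun i j l x hx y hy => pdy_comm hU (sG i) hx hy j l
  have eGa : ∀ i l, ∀ x ∈ U, ∀ y : Vec n, y ≠ 0 →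
      ∑ j, Ga G i j l x y * y j = Nc G i l x y := by
    intro i l x hx y hy
    simp only [symm i _ l x hx y hy]
    have h := ((hom i).pdy l).euler hU (sN i l) hx hy
    rwa [Nat.cast_one, one_mul] at h
  have xGa : ∀ l m, ∑ j, pdx (Ga G i j l) m x y * y j = pdx (Nc G i l) m x y := by
    intro l m
    rw [← pdx_congr hU (eGa i l) hx hy, pdx_sum_coord_mul hU (fun j => sGa i j l) hx hy]
  have yGa : ∀ l m, ∑ j, pdy (Ga G i j l) m x y * y j = 0 := by
    intro l m
    have h := pdy_sum_coord_mul hU (fun j => sGa i j l) hx hy m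
    rw [pdy_congr (eGa i l) hx hy, symm i m l x hx y hy] at h
    exact left_eq_add.mp (h.trans (add_comm _ _))
  have xN : ∑ l, pdx (Nc G i l) k x y * y l = 2 * pdx (G i) k x y := by
    rw [← pdx_sum_coord_mul hU (fun l => sN i l) hx hy, pdx_congr hU (eN i) hx hy,
      pdx_mul_const, mul_comm]
  have hhd : ∀ l m, ∑ j, hd G (Ga G i j l) m x y * y j = pdx (Nc G i l) m x y := by
    intro l m
    simp only [hd, sub_mul, Finset.sum_sub_distrib, xGa, Finset.sum_mul]
    rw [Finset.sum_comm]
    simp only [mul_assoc, ← Finset.mul_sum, yGa]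
    simp
  have hquad : ∀ l, ∑ j, (∑ s, (Ga G i k s x y * Ga G s j l x y
        - Ga G s j k x y * Ga G i l s x y)) * y j
      = ∑ s, (Ga G i k s x y * Nc G s l x y - Nc G s k x y * Ga G i l s x y) := by
    intro l
    simp only [Finset.sum_mul]
    rw [Finset.sum_comm]
    refine Finset.sum_congr rfl fun s _ => ?_
    rw [← eGa s l x hx y hy, ← eGa s k x hx y hy, Finset.mul_sum, Finset.sum_mul,
      ← Finset.sum_sub_distrib]
    exact Finset.sum_congr rfl fun j _ => by ring
  have hcontr : ∀ l, ∑ j, Riem4 G j i k l x y * y j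
      = pdx (Nc G i l) k x y - pdx (Nc G i k) l x y
        + ∑ s, (Ga G i k s x y * Nc G s l x y - Nc G s k x y * Ga G i l s x y) := by
    intro l
    rw [← hquad, ← hhd l k, ← hhd k l, ← Finset.sum_sub_distrib, ← Finset.sum_add_distrib]
    exact Finset.sum_congr rfl fun j _ => by rw [Riem4]; ring
  have hR : Riem2 G i k x y = ∑ l, (∑ j, Riem4 G j i k l x y * y j) * y l := by
    rw [Riem2, Finset.sum_comm]
    simp only [Finset.sum_mul]
    exact Finset.sum_congr rfl fun l _ => Finset.sum_congr rfl fun j _ => by ring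
  have hquad' : ∑ l, (∑ s, (Ga G i k s x y * Nc G s l x y
        - Nc G s k x y * Ga G i l s x y)) * y l
      = ∑ s, 2 * G s x y * Ga G i k s x y - ∑ s, Nc G s k x y * Nc G i s x y := by
    simp only [Finset.sum_mul]
    rw [Finset.sum_comm, ← Finset.sum_sub_distrib]
    refine Finset.sum_congr rfl fun s _ => ?_
    rw [← eGa i s x hx y hy, mul_comm 2, ← eN s x hx y hy, Finset.mul_sum, Finset.sum_mul,
      ← Finset.sum_sub_distrib]
    exact Finset.sum_congr rfl fun l _ => by ring
  simp only [hR, hcontr]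
  rw [← xN, add_sub_assoc, ← hquad', ← Finset.sum_sub_distrib, ← Finset.sum_add_distrib]
  exact Finset.sum_congr rfl fun l _ => by ring

/-- If `Rⁱ_k = Ξ δⁱ_k + τ_k yⁱ` with `τ_k y^k = -Ξ`, then `Ξ` is the scalar `R`. -/
theorem rsc_eq_of_riem2_eq (hn : 2 ≤ n) {G : Fin n → Vec n → Vec n → ℝ}
    {Ξ : Vec n → Vec n → ℝ} {τ : Fin n → Vec n → Vec n → ℝ} {x y : Vec n}
    (hR : ∀ i k, Riem2 G i k x y = Ξ x y * (if i = k then 1 else 0) + τ k x y * y i)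
    (htr : ∑ k, τ k x y * y k = Ξ x y * (-1)) : Rsc G x y = Ξ x y := by
  have hn' : (n : ℝ) - 1 ≠ 0 := by
    have : (2 : ℝ) ≤ n := by exact_mod_cast hn
    linarith
  simp only [Rsc, hR, Finset.sum_add_distrib, htr]
  simp
  field_simp
  ring

/-- If `Rⁱ_k = Ξ δⁱ_k + τ_k yⁱ` with `τ_k` homogeneous of degree one and `τ_k y^k = -Ξ`, then
`χ_k = -((n+1)/6) (Ξ_{·k} + 2 τ_k)`. -/
theorem chi_eq_of_riem2_eq {U : Set (Vec n)} (hU : IsOpen U) {G : Fin n → Vec n → Vec n → ℝ}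
    {Ξ : Vec n → Vec n → ℝ} {τ : Fin n → Vec n → Vec n → ℝ}
    (hΞ : SmoothOnSlit U Ξ) (hτ : ∀ k, SmoothOnSlit U (τ k)) (hτhom : ∀ k, PosHomFiber 1 (τ k))
    (hR : ∀ i k, ∀ x ∈ U, ∀ y : Vec n, y ≠ 0 →
      Riem2 G i k x y = Ξ x y * (if i = k then 1 else 0) + τ k x y * y i)
    (htr : ∀ x ∈ U, ∀ y : Vec n, y ≠ 0 → ∑ k, τ k x y * y k = Ξ x y * (-1))
    {x y : Vec n} (hx : x ∈ U) (hy : y ≠ 0) (k : Fin n) :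
    chi G k x y = -((n + 1) / 6) * (pdy Ξ k x y + 2 * τ k x y) := by
  have hd : ∀ i k m, pdy (Riem2 G i k) m x y
      = pdy Ξ m x y * (if i = k then 1 else 0)
        + (pdy (τ k) m x y * y i + τ k x y * (if i = m then 1 else 0)) := by
    intro i k m
    rw [pdy_congr (hR i k) hx hy, pdy_add hU (hΞ.mul (SmoothOnSlit.const _))
      ((hτ k).mul (SmoothOnSlit.coord i)) hx hy, pdy_mul_const,
      pdy_mul_coord hU (hτ k) hx hy]
  have htr' : ∑ m, pdy (τ m) k x y * y m + τ k x y = pdy Ξ k x y * (-1) := by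
    rw [← pdy_sum_coord_mul hU hτ hx hy, pdy_congr htr hx hy, pdy_mul_const]
  have heul := (hτhom k).euler hU (hτ k) hx hy
  simp only [chi, hd, Finset.sum_add_distrib, heul]
  simp
  linear_combination (1 / 6 : ℝ) * htr'

/-- a projectively flat spray (in the given coordinates) with `χ = 0` is of
isotropic curvature. -/
theorem projectively_flat_chi_zero_isotropic
    {n : ℕ} (hn : 2 ≤ n) (U : Set (Vec n)) (hU : IsOpen U)
    (G : Fin n → Vec n → Vec n → ℝ) (hG : IsSpray U G)
    (P : Vec n → Vec n → ℝ)
    (hPsm : ContDiffOn ℝ (⊤ : ℕ∞) (fun p : Vec n × Vec n => P p.1 p.2)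
      (U ×ˢ {y : Vec n | y ≠ 0}))
    (hPhom : ∀ (x y : Vec n) (lam : ℝ), 0 < lam → P x (lam • y) = lam * P x y)
    (hform : ∀ i, ∀ x ∈ U, ∀ y : Vec n, y ≠ 0 → G i x y = P x y * y i)
    (hchi : ∀ x ∈ U, ∀ y : Vec n, y ≠ 0 → ∀ k, chi G k x y = 0) :
    IsIsotropicCurv U G := by
  have hP : SmoothOnSlit U P := hPsm
  have hP1 : PosHomFiber 1 P := fun x y lam hlam => by rw [pow_one, hPhom x y lam hlam]
  have sPy : ∀ k, SmoothOnSlit U (pdy P k) := hP.pdy hU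
  have sPx : ∀ k, SmoothOnSlit U (pdx P k) := hP.pdx hU
  have sPyx : ∀ k l, SmoothOnSlit U (pdx (pdy P k) l) := fun k => (sPy k).pdx hU
  set Ξ : Vec n → Vec n → ℝ := fun x y => P x y * P x y - ∑ l, pdx P l x y * y l with hΞ
  set τ : Fin n → Vec n → Vec n → ℝ := fun k x y =>
    2 * pdx P k x y - P x y * pdy P k x y - ∑ l, pdx (pdy P k) l x y * y l with hτ
  have sΞ : SmoothOnSlit U Ξ :=
    (hP.mul hP).sub (.sum fun l => (sPx l).mul (.coord l))
  have sτ : ∀ k, SmoothOnSlit U (τ k) := fun k =>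
    (((SmoothOnSlit.const 2).mul (sPx k)).sub (hP.mul (sPy k))).sub
      (.sum fun l => (sPyx k l).mul (.coord l))
  have homPy : ∀ k, PosHomFiber 0 (pdy P k) := fun k => PosHomFiber.pdy hP1 k
  have homτ : ∀ k, PosHomFiber 1 (τ k) := by
    intro k
    have h1 : PosHomFiber 1 fun x y => 2 * pdx P k x y := by
      simpa using (PosHomFiber.const 2).mul (hP1.pdx k)
    have h2 : PosHomFiber 1 fun x y => ∑ l, pdx (pdy P k) l x y * y l :=
      .sum fun l => by simpa using ((homPy k).pdx l).mul (PosHomFiber.coord l)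
    exact (h1.sub (hP1.mul (homPy k))).sub h2
  have euler : ∀ x ∈ U, ∀ y : Vec n, y ≠ 0 → ∑ k, pdy P k x y * y k = P x y := by
    intro x hx y hy
    simpa using hP1.euler hU hP hx hy
  have hN : ∀ i k, ∀ x ∈ U, ∀ y : Vec n, y ≠ 0 →
      Nc G i k x y = pdy P k x y * y i + P x y * (if i = k then 1 else 0) := by
    intro i k x hx y hy
    rw [Nc, pdy_congr (hform i) hx hy, pdy_mul_coord hU hP hx hy]
  have hR : ∀ i k, ∀ x ∈ U, ∀ y : Vec n, y ≠ 0 →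
      Riem2 G i k x y = Ξ x y * (if i = k then 1 else 0) + τ k x y * y i := by
    intro i k x hx y hy
    have hGx : pdx (G i) k x y = pdx P k x y * y i := by
      rw [pdx_congr hU (hform i) hx hy, pdx_mul_coord]
    have hNx : ∀ l, pdx (Nc G i k) l x y
        = pdx (pdy P k) l x y * y i + pdx P l x y * (if i = k then 1 else 0) := by
      intro l
      rw [pdx_congr hU (hN i k) hx hy, pdx_add hU ((sPy k).mul (.coord i))
        (hP.mul (.const _)) hx hy, pdx_mul_coord, pdx_mul_const]
    have hΓ : ∑ s, 2 * G s x y * Ga G i k s x y = 2 * P x y * Nc G i k x y := by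
      have h := PosHomFiber.euler (d := 1) (PosHomFiber.pdy (hG.2 i) k) hU
        (SmoothOnSlit.pdy (hG.1 i) hU k) hx hy
      rw [Nat.cast_one, one_mul] at h
      change _ = 2 * P x y * pdy (G i) k x y
      rw [← h, Finset.mul_sum]
      refine Finset.sum_congr rfl fun s _ => ?_
      rw [hform s x hx y hy, Ga]
      change 2 * (P x y * y s) * pdy (pdy (G i) k) s x y = _
      ring
    have hNN : ∑ s, Nc G s k x y * Nc G i s x y
        = 3 * P x y * pdy P k x y * y i + P x y * P x y * (if i = k then 1 else 0) := by
      have h : ∀ s, Nc G s k x y * Nc G i s x y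
          = pdy P k x y * y i * (pdy P s x y * y s)
            + (if i = s then pdy P k x y * P x y * y s else 0)
            + (if s = k then P x y * Nc G i s x y else 0) := by
        intro s
        rw [hN s k x hx y hy, hN i s x hx y hy]
        split_ifs <;> ring
      simp only [h, Finset.sum_add_distrib, ← Finset.mul_sum, euler x hx y hy,
        Finset.sum_ite_eq, Finset.sum_ite_eq', Finset.mem_univ, if_true]
      rw [hN i k x hx y hy]
      ring
    rw [hG.riem2_eq hU hx hy, hGx, hΓ, hNN, hN i k x hx y hy]
    have hsum : ∑ l, pdx (Nc G i k) l x y * y l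
        = (∑ l, pdx (pdy P k) l x y * y l) * y i
          + (∑ l, pdx P l x y * y l) * (if i = k then 1 else 0) := by
      rw [Finset.sum_mul, Finset.sum_mul, ← Finset.sum_add_distrib]
      exact Finset.sum_congr rfl fun l _ => by rw [hNx]; ring
    rw [hsum]
    simp only [hΞ, hτ]
    ring
  have htr : ∀ x ∈ U, ∀ y : Vec n, y ≠ 0 → ∑ k, τ k x y * y k = Ξ x y * (-1) := by
    intro x hx y hy
    have hmixed : ∑ k, (∑ l, pdx (pdy P k) l x y * y l) * y k = ∑ l, pdx P l x y * y l := by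
      simp only [Finset.sum_mul]
      rw [Finset.sum_comm]
      refine Finset.sum_congr rfl fun l _ => ?_
      rw [← pdx_congr hU euler hx hy, pdx_sum_coord_mul hU sPy hx hy, Finset.sum_mul]
      exact Finset.sum_congr rfl fun k _ => by ring
    simp only [hτ, hΞ, sub_mul, Finset.sum_sub_distrib, hmixed]
    simp only [mul_assoc, ← Finset.mul_sum, euler x hx y hy]
    ring
  have hRsc : ∀ x ∈ U, ∀ y : Vec n, y ≠ 0 → Rsc G x y = Ξ x y := fun x hx y hy =>
    rsc_eq_of_riem2_eq hn (fun i k => hR i k x hx y hy) (htr x hx y hy)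
  intro x hx y hy i k
  have hχ := hchi x hx y hy k
  rw [chi_eq_of_riem2_eq hU sΞ sτ homτ hR htr hx hy] at hχ
  have hn1 : -(((n : ℝ) + 1) / 6) ≠ 0 := by
    have : (0 : ℝ) < n + 1 := by positivity
    exact neg_ne_zero.mpr (by positivity)
  have hτk := (mul_eq_zero.mp hχ).resolve_left hn1
  rw [hR i k x hx y hy, hRsc x hx y hy, pdy_congr hRsc hx hy]
  linear_combination (1 / 2 : ℝ) * y i * hτk
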